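/- For every M with 0 < M < π/2, the improper integral ∫₀^M dH / √(sin²M − sin²H) is strictly greater than π/2. -/

import Mathlib

open Real MeasureTheory

noncomputable section

lemma sin_lt_sin_of_mem_Ioo {M x : ℝ} (hM : M < π / 2) (hx : x ∈ Set.Ioo 0 M) :
    Real.sin x < Real.sin M :=
  Real.sin_lt_sin_of_lt_of_le_pi_div_two (by linarith [hx.1, Real.pi_pos]) hM.le hx.2

lemma sin_sq_sub_sin_sq_pos {M x : ℝ} (hM : M < π / 2) (hx : x ∈ Set.Ioo 0 M) :
    0 < Real.sin M ^ 2 - Real.sin x ^ 2 := by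
  have h0 : 0 < Real.sin x :=
    Real.sin_pos_of_pos_of_lt_pi hx.1 (by linarith [hx.2, Real.pi_pos])
  nlinarith [sin_lt_sin_of_mem_Ioo hM hx]

lemma hasDerivAt_arcsin_sin_div_sin {M x : ℝ} (hM : M < π / 2) (hx : x ∈ Set.Ioo 0 M) :
    HasDerivAt (fun y => Real.arcsin (Real.sin y / Real.sin M))
      (Real.cos x / √(Real.sin M ^ 2 - Real.sin x ^ 2)) x := by
  have h0 : 0 < Real.sin x :=
    Real.sin_pos_of_pos_of_lt_pi hx.1 (by linarith [hx.2, Real.pi_pos])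
  have hlt := sin_lt_sin_of_mem_Ioo hM hx
  have hs : 0 < Real.sin M := h0.trans hlt
  have h1 : Real.sin x / Real.sin M < 1 := (div_lt_one hs).2 hlt
  have h2 : 0 < Real.sin x / Real.sin M := div_pos h0 hs
  have h := (Real.hasDerivAt_arcsin (by linarith) h1.ne).comp x
    ((Real.hasDerivAt_sin x).div_const (Real.sin M))
  refine h.congr_deriv ?_
  have hd : 1 - (Real.sin x / Real.sin M) ^ 2
      = (Real.sin M ^ 2 - Real.sin x ^ 2) / Real.sin M ^ 2 := by
    field_simp
  have hr : 0 < √(Real.sin M ^ 2 - Real.sin x ^ 2) :=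
    Real.sqrt_pos.2 (sin_sq_sub_sin_sq_pos hM hx)
  rw [hd, Real.sqrt_div' _ (sq_nonneg _), Real.sqrt_sq hs.le]
  field_simp

/-- For every `0 < M < π/2`, the improper integral
`∫₀^M dH / √(sin²M - sin²H)` is strictly greater than `π/2`. -/
theorem integral_gt_pi_div_two (M : ℝ) (hM0 : 0 < M) (hM : M < π / 2) :
    π / 2 < ∫ x in Set.Ioo 0 M,
      1 / Real.sqrt (Real.sin M ^ 2 - Real.sin x ^ 2) := by
  have hs : 0 < Real.sin M := Real.sin_pos_of_pos_of_lt_pi hM0 (by linarith [Real.pi_pos])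
  have hcM : 0 < Real.cos M := Real.cos_pos_of_mem_Ioo ⟨by linarith, hM⟩
  have hcont : ContinuousOn (fun y => Real.arcsin (Real.sin y / Real.sin M)) (Set.Icc 0 M) :=
    (Real.continuous_arcsin.comp (Real.continuous_sin.div_const _)).continuousOn
  have hcos : ∀ x ∈ Set.Ioo 0 M, Real.cos M < Real.cos x ∧ Real.cos x < 1 := fun x hx => by
    refine ⟨Real.cos_lt_cos_of_nonneg_of_le_pi_div_two hx.1.le hM.le hx.2, ?_⟩
    simpa using Real.cos_lt_cos_of_nonneg_of_le_pi_div_two le_rfl (hx.2.trans hM).le hx.1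
  have hr : ∀ x ∈ Set.Ioo 0 M, 0 < √(Real.sin M ^ 2 - Real.sin x ^ 2) := fun x hx =>
    Real.sqrt_pos.2 (sin_sq_sub_sin_sq_pos hM hx)
  have hg : IntegrableOn (fun x => Real.cos x / √(Real.sin M ^ 2 - Real.sin x ^ 2))
      (Set.Ioc 0 M) :=
    intervalIntegral.integrableOn_deriv_of_nonneg hcont
      (fun x hx => hasDerivAt_arcsin_sin_div_sin hM hx)
      (fun x hx => div_nonneg (hcM.trans (hcos x hx).1).le (hr x hx).le)
  have hgi := (intervalIntegrable_iff_integrableOn_Ioc_of_le hM0.le).2 hg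
  have hgval : ∫ x in (0 : ℝ)..M, Real.cos x / √(Real.sin M ^ 2 - Real.sin x ^ 2) = π / 2 := by
    rw [intervalIntegral.integral_eq_sub_of_hasDerivAt_of_le hM0.le hcont
      (fun x hx => hasDerivAt_arcsin_sin_div_sin hM hx) hgi]
    simp [div_self hs.ne']
  have hf : IntegrableOn (fun x => 1 / √(Real.sin M ^ 2 - Real.sin x ^ 2)) (Set.Ioo 0 M) := by
    refine Integrable.mono' ((hg.mono_set Set.Ioo_subset_Ioc_self).const_mul (1 / Real.cos M))
      (Measurable.aestronglyMeasurable (by fun_prop)) ?_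
    filter_upwards [ae_restrict_mem measurableSet_Ioo] with x hx
    have := hr x hx
    rw [Real.norm_of_nonneg (by positivity), ← mul_div_assoc]
    gcongr
    rw [one_div_mul_eq_div, one_le_div hcM]
    exact (hcos x hx).1.le
  have hfi := (intervalIntegrable_iff_integrableOn_Ioo_of_le hM0.le).2 hf
  have hpos := intervalIntegral.intervalIntegral_pos_of_pos_on (hfi.sub hgi)
    (fun x hx => sub_pos.2 (div_lt_div_of_pos_right (hcos x hx).2 (hr x hx))) hM0
  rw [intervalIntegral.integral_sub hfi hgi, hgval, intervalIntegral.integral_of_le hM0.le,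
    integral_Ioc_eq_integral_Ioo] at hpos
  linarith
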